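/- Let k be a perfect field and let X and Y be varieties over k that are stably birationally equivalent. Let i be an integer with 0 ≤ i ≤ dim X and 0 ≤ i ≤ dim Y. Then X is retract (-i)-rational if and only if Y is retract (-i)-rational. -/

import Mathlib

open AlgebraicGeometry CategoryTheory CategoryTheory.Limits

universe u

variable (k : Type u) [Field k]

/-- `Spec k`, the base scheme. -/
noncomputable abbrev Sk : Scheme.{u} := Spec (CommRingCat.of k)

/-- Affine `m`-space over `k`. -/
noncomputable def AffSp (m : ℕ) : Scheme.{u} := Spec (CommRingCat.of (MvPolynomial (Fin m) k))

/-- The structure morphism of affine `m`-space over `k`. -/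
noncomputable def AffSpStr (m : ℕ) : AffSp k m ⟶ Sk k :=
  Spec.map (CommRingCat.ofHom (algebraMap k (MvPolynomial (Fin m) k)))

/-- The product (fibre product over `Spec k`) of two `k`-schemes. -/
noncomputable def prodK {X Y : Scheme.{u}} (sX : X ⟶ Sk k) (sY : Y ⟶ Sk k) : Scheme.{u} :=
  pullback sX sY

/-- The structure morphism of the product of two `k`-schemes. -/
noncomputable def prodKStr {X Y : Scheme.{u}} (sX : X ⟶ Sk k) (sY : Y ⟶ Sk k) :
    prodK k sX sY ⟶ Sk k :=
  pullback.fst sX sY ≫ sX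

/-- A birational map (birational equivalence) between two `k`-schemes: dense open subschemes
`U ⊆ X`, `V ⊆ Y` together with an isomorphism `U ≅ V` of `k`-schemes. -/
def BirEquiv {X Y : Scheme.{u}} (sX : X ⟶ Sk k) (sY : Y ⟶ Sk k) : Prop :=
  ∃ (U : X.Opens) (V : Y.Opens) (e : (U : Scheme.{u}) ≅ (V : Scheme.{u})),
    Dense (U : Set X) ∧ Dense (V : Set Y) ∧ e.hom ≫ V.ι ≫ sY = U.ι ≫ sX

/-- `X` (with structure morphism `sX`) is an `n`-dimensional variety over `k`:
integral, separated and of finite type, of Krull dimension `n`. -/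
def IsVarietyDim {X : Scheme.{u}} (sX : X ⟶ Sk k) (n : ℕ) : Prop :=
  IsIntegral X ∧ IsSeparated sX ∧ LocallyOfFiniteType sX ∧ QuasiCompact sX ∧
    topologicalKrullDim X = (n : ℕ∞)

/-- `Z` (with structure morphism `sZ`) is an `i`-dimensional smooth variety over `k`,
where for `i = 0` it is required to be `Spec k` itself (i.e. `sZ` is an isomorphism). -/
def IsSmoothVarietyDim {Z : Scheme.{u}} (sZ : Z ⟶ Sk k) (i : ℕ) : Prop :=
  IsVarietyDim k sZ i ∧ IsSmooth sZ ∧ (i = 0 → IsIso sZ)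

/-- `X` is `(-i)`-rational: there are an `i`-dimensional smooth variety `Z` over `k`
(`Z = Spec k` when `i = 0`) and a birational map `𝔸^{n-i} × Z ⇢ X`. -/
def MinusRational {X : Scheme.{u}} (sX : X ⟶ Sk k) (n i : ℕ) : Prop :=
  ∃ (Z : Scheme.{u}) (sZ : Z ⟶ Sk k), IsSmoothVarietyDim k sZ i ∧
    BirEquiv k (prodKStr k (AffSpStr k (n - i)) sZ) sX

/-- `X` is stable `(-i)`-rational: there are `N ≥ n`, an `i`-dimensional smooth variety `Z`
over `k` (`Z = Spec k` when `i = 0`) and a birational map `𝔸^{N-i} × Z ⇢ 𝔸^{N-n} × X`. -/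
def StableMinusRational {X : Scheme.{u}} (sX : X ⟶ Sk k) (n i : ℕ) : Prop :=
  ∃ N : ℕ, n ≤ N ∧ ∃ (Z : Scheme.{u}) (sZ : Z ⟶ Sk k), IsSmoothVarietyDim k sZ i ∧
    BirEquiv k (prodKStr k (AffSpStr k (N - i)) sZ) (prodKStr k (AffSpStr k (N - n)) sX)

/-- `X` is retract `(-i)`-rational: there are `N ≥ n`, an `i`-dimensional smooth variety `Z`
over `k` (`Z = Spec k` when `i = 0`), dense opens `U ⊆ U' ⊆ X` and `V ⊆ 𝔸^{N-i} × Z`, and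
`k`-morphisms `f : U → V`, `g : V → U'` with `g ∘ f : U → X` equal to the open inclusion. -/
def RetractMinusRational {X : Scheme.{u}} (sX : X ⟶ Sk k) (n i : ℕ) : Prop :=
  ∃ N : ℕ, n ≤ N ∧ ∃ (Z : Scheme.{u}) (sZ : Z ⟶ Sk k), IsSmoothVarietyDim k sZ i ∧
    ∃ (U U' : X.Opens) (V : (prodK k (AffSpStr k (N - i)) sZ).Opens),
      U ≤ U' ∧ Dense (U : Set X) ∧ Dense (U' : Set X) ∧
      Dense (V : Set (prodK k (AffSpStr k (N - i)) sZ)) ∧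
      ∃ (f : (U : Scheme.{u}) ⟶ (V : Scheme.{u})) (g : (V : Scheme.{u}) ⟶ (U' : Scheme.{u})),
        f ≫ V.ι ≫ prodKStr k (AffSpStr k (N - i)) sZ = U.ι ≫ sX ∧
        g ≫ U'.ι ≫ sX = V.ι ≫ prodKStr k (AffSpStr k (N - i)) sZ ∧
        f ≫ g ≫ U'.ι = U.ι

/-- `X` and `Y` are stably birationally equivalent. -/
def StablyBirEquiv {X Y : Scheme.{u}} (sX : X ⟶ Sk k) (sY : Y ⟶ Sk k) : Prop :=
  ∃ r s : ℕ,
    BirEquiv k (prodKStr k (AffSpStr k r) sX) (prodKStr k (AffSpStr k s) sY)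


/-! ### Affine space -/

/-- The polynomial ring as an object of `CommRingCat`. -/
noncomputable abbrev polyR (m : ℕ) : CommRingCat.{u} := CommRingCat.of (MvPolynomial (Fin m) k)

/-- The structure map of the polynomial ring. -/
noncomputable abbrev polyC (m : ℕ) : CommRingCat.of k ⟶ polyR k m :=
  CommRingCat.ofHom (algebraMap k (MvPolynomial (Fin m) k))

/-- The map of polynomial rings induced by a map of variables. -/
noncomputable abbrev polyRen {m M : ℕ} (ι : Fin m → Fin M) : polyR k m ⟶ polyR k M :=
  CommRingCat.ofHom (MvPolynomial.rename ι : _ →ₐ[k] _).toRingHom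

lemma polyC_ren {m M : ℕ} (ι : Fin m → Fin M) :
    polyC k m ≫ polyRen k ι = polyC k M := by
  ext x
  simp

lemma hom_to_Spec_eq {T : Scheme.{u}} {R : CommRingCat.{u}} (c : T ⟶ Spec R) :
    ∃ φ : R ⟶ Γ(T, ⊤), c = T.toSpecΓ ≫ Spec.map φ := by
  refine ⟨(Scheme.ΓSpecIso R).inv ≫ c.appTop, ?_⟩
  rw [Spec.map_comp, ← Scheme.toSpecΓ_naturality_assoc]
  simp

lemma toSpecΓ_map_inj {T : Scheme.{u}} {R : CommRingCat.{u}} {φ ψ : R ⟶ Γ(T, ⊤)}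
    (h : T.toSpecΓ ≫ Spec.map φ = T.toSpecΓ ≫ Spec.map ψ) : φ = ψ := by
  have h2 := congrArg (fun c => (Scheme.ΓSpecIso R).inv ≫ Scheme.Hom.appTop c) h
  simpa using h2

lemma exists_affLift_aux {m r M : ℕ} (h : m + r ≤ M) :
    ∃ (p : Spec (polyR k M) ⟶ Spec (polyR k m)) (q : Spec (polyR k M) ⟶ Spec (polyR k r)),
      p ≫ Spec.map (polyC k m) = Spec.map (polyC k M) ∧
      q ≫ Spec.map (polyC k r) = Spec.map (polyC k M) ∧
      ∀ (T : Scheme.{u}) (a : T ⟶ Spec (polyR k m)) (b : T ⟶ Spec (polyR k r)),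
        a ≫ Spec.map (polyC k m) = b ≫ Spec.map (polyC k r) →
        ∃ c : T ⟶ Spec (polyR k M), c ≫ p = a ∧ c ≫ q = b := by
  let ι₁ : Fin m → Fin M := fun j => ⟨j, by omega⟩
  let ι₂ : Fin r → Fin M := fun j => ⟨m + j, by omega⟩
  refine ⟨Spec.map (polyRen k ι₁), Spec.map (polyRen k ι₂),
    by rw [← Spec.map_comp, polyC_ren], by rw [← Spec.map_comp, polyC_ren], ?_⟩
  intro T a b hab
  obtain ⟨φ, rfl⟩ := hom_to_Spec_eq a
  obtain ⟨ψ, rfl⟩ := hom_to_Spec_eq b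
  rw [Category.assoc, Category.assoc, ← Spec.map_comp, ← Spec.map_comp] at hab
  have hC := toSpecΓ_map_inj hab
  have hC' : ∀ x : k, φ.hom (MvPolynomial.C x) = ψ.hom (MvPolynomial.C x) := fun x => by
    have := congrArg (fun f => f.hom x) hC
    simpa using this
  let v : Fin M → Γ(T, ⊤) := fun l =>
    if h1 : (l : ℕ) < m then φ.hom (MvPolynomial.X ⟨l, h1⟩) else
      if h2 : (l : ℕ) - m < r then ψ.hom (MvPolynomial.X ⟨l - m, h2⟩) else 0
  have hv1 : ∀ j, v (ι₁ j) = φ.hom (MvPolynomial.X j) := fun j => by simp [v, ι₁]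
  have hv2 : ∀ j, v (ι₂ j) = ψ.hom (MvPolynomial.X j) := fun j => by simp [v, ι₂]
  let χ : MvPolynomial (Fin M) k →+* Γ(T, ⊤) :=
    MvPolynomial.eval₂Hom (φ.hom.comp MvPolynomial.C) v
  refine ⟨T.toSpecΓ ≫ Spec.map (CommRingCat.ofHom χ), ?_, ?_⟩
  · rw [Category.assoc, ← Spec.map_comp]
    congr 2
    apply CommRingCat.hom_ext
    apply MvPolynomial.ringHom_ext
    · intro x; simp [χ]
    · intro j; simp [χ, hv1]
  · rw [Category.assoc, ← Spec.map_comp]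
    congr 2
    apply CommRingCat.hom_ext
    apply MvPolynomial.ringHom_ext
    · intro x; simp [χ, hC']
    · intro j; simp [χ, hv2]

/-- `𝔸^M` maps to `𝔸^m × 𝔸^r` and every pair of morphisms lifts, when `m + r ≤ M`. -/
lemma exists_affLift {m r M : ℕ} (h : m + r ≤ M) :
    ∃ (p : AffSp k M ⟶ AffSp k m) (q : AffSp k M ⟶ AffSp k r),
      p ≫ AffSpStr k m = AffSpStr k M ∧ q ≫ AffSpStr k r = AffSpStr k M ∧
      ∀ (T : Scheme.{u}) (a : T ⟶ AffSp k m) (b : T ⟶ AffSp k r),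
        a ≫ AffSpStr k m = b ≫ AffSpStr k r →
        ∃ c : T ⟶ AffSp k M, c ≫ p = a ∧ c ≫ q = b :=
  exists_affLift_aux k h

/-- Affine space over a `k`-algebra is a base change. -/
lemma affSp_isPullback_aux (m : ℕ) (B : CommRingCat.{u}) (φ : CommRingCat.of k ⟶ B) :
    IsPullback (Spec.map (CommRingCat.ofHom (MvPolynomial.map (σ := Fin m) φ.hom)))
      (Spec.map (CommRingCat.ofHom (MvPolynomial.C (σ := Fin m) (R := B))))
      (Spec.map (polyC k m)) (Spec.map φ) := by
  let : Algebra k B := φ.hom.toAlgebra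
  let : Algebra (MvPolynomial (Fin m) k) (MvPolynomial (Fin m) B) :=
    MvPolynomial.algebraMvPolynomial
  exact isPullback_SpecMap_of_isPushout _ _ _ _ (CommRingCat.isPushout_of_isPushout k
    (MvPolynomial (Fin m) k) B (MvPolynomial (Fin m) B))

/-- Affine space over a `k`-algebra. -/
noncomputable def affB (m : ℕ) (B : CommRingCat.{u}) : Scheme.{u} :=
  Spec (CommRingCat.of (MvPolynomial (Fin m) B))

/-- The structure map of affine space over a `k`-algebra. -/
noncomputable def affBStr (m : ℕ) (B : CommRingCat.{u}) : affB m B ⟶ Spec B :=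
  Spec.map (CommRingCat.ofHom (MvPolynomial.C (σ := Fin m) (R := B)))

lemma affSp_isPullback (m : ℕ) (B : CommRingCat.{u}) (b : Spec B ⟶ Sk k) :
    ∃ j : affB m B ⟶ AffSp k m, IsPullback j (affBStr m B) (AffSpStr k m) b := by
  obtain ⟨φ, rfl⟩ := Spec.map_surjective b
  exact ⟨_, affSp_isPullback_aux k m B φ⟩

instance geomIrr_affSp (m : ℕ) : GeometricallyIrreducible (AffSpStr k m) := by
  rw [geometricallyIrreducible_iff]
  intro K _ y Z f g h
  obtain ⟨j, hj⟩ := affSp_isPullback k m (CommRingCat.of K) y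
  apply ObjectProperty.prop_of_iso _ (h.isoIsPullback _ _ hj).symm
  change IrreducibleSpace (Spec (CommRingCat.of (MvPolynomial (Fin m) K)))
  infer_instance

instance univOpen_affSp (m : ℕ) : UniversallyOpen (AffSpStr k m) := by
  infer_instance

instance irr_prodK {Z : Scheme.{u}} (sZ : Z ⟶ Sk k) [IrreducibleSpace Z] (m : ℕ) :
    IrreducibleSpace (prodK k (AffSpStr k m) sZ) := by
  unfold prodK
  infer_instance

/-- Sections exist over an infinite base, hitting any nonempty open. -/
lemma exists_section_aux (m : ℕ) (B : CommRingCat.{u}) [IsDomain B] [Infinite B]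
    (U : (affB m B).Opens) (hU : (U : Set (affB m B)).Nonempty) :
    ∃ σ : Spec B ⟶ affB m B, σ ≫ affBStr m B = 𝟙 _ ∧
      ((σ ⁻¹ᵁ U : (Spec B).Opens) : Set (Spec B)).Nonempty := by
  obtain ⟨x, hx⟩ := hU
  obtain ⟨_, ⟨F, rfl⟩, hxF, hFU⟩ := (PrimeSpectrum.isTopologicalBasis_basic_opens
    (R := MvPolynomial (Fin m) B)).exists_subset_of_mem_open hx U.2
  have hF : F ≠ 0 := by
    rintro rfl
    simp only [PrimeSpectrum.basicOpen_zero] at hxF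
    exact hxF
  obtain ⟨b, hb⟩ : ∃ b : Fin m → B, MvPolynomial.eval b F ≠ 0 := by
    by_contra! hcon
    exact hF (MvPolynomial.funext (by simpa using hcon))
  refine ⟨Spec.map (CommRingCat.ofHom (MvPolynomial.eval b)), ?_, ?_⟩
  · refine (Spec.map_comp _ _).symm.trans ?_
    rw [← Spec.map_id]
    congr 1
    ext x
    simp
  · refine ⟨(⟨⊥, Ideal.isPrime_bot⟩ : PrimeSpectrum B), ?_⟩
    apply hFU
    change F ∉ Ideal.comap (MvPolynomial.eval b) ⊥
    simpa using hb

lemma exists_section {Y : Scheme.{u}} [IsIntegral Y] (sY : Y ⟶ Sk k) (m : ℕ)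
    (Y₀ : Y.Opens) (hY₀ : IsAffineOpen Y₀) (hne : Nonempty Y₀) (hinf : Infinite Γ(Y, Y₀))
    {P : Scheme.{u}} {p₁ : P ⟶ AffSp k m} {p₂ : P ⟶ Y} (hP : IsPullback p₁ p₂ (AffSpStr k m) sY)
    (U : P.Opens) (hU : (U : Set P).Nonempty) :
    ∃ (S : Scheme.{u}) (a : S ⟶ Y) (_ : IsOpenImmersion a) (σ : S ⟶ P),
      σ ≫ p₂ = a ∧ ((σ ⁻¹ᵁ U : S.Opens) : Set S).Nonempty := by
  obtain ⟨j, hj⟩ := affSp_isPullback k m Γ(Y, Y₀) (hY₀.fromSpec ≫ sY)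
  let J : affB m Γ(Y, Y₀) ⟶ P :=
    hP.lift j (affBStr _ _ ≫ hY₀.fromSpec) (by simpa using hj.w)
  have hJ1 : J ≫ p₁ = j := hP.lift_fst _ _ _
  have hJ2 : J ≫ p₂ = affBStr _ _ ≫ hY₀.fromSpec := hP.lift_snd _ _ _
  have hP' : IsPullback J (affBStr _ _) p₂ hY₀.fromSpec := by
    refine IsPullback.of_right ?_ hJ2 hP
    rw [hJ1]
    exact hj
  have : IsDomain Γ(Y, Y₀) := inferInstance
  have : UniversallyOpen p₂ := MorphismProperty.of_isPullback hP (univOpen_affSp k m)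
  have hd : Dense (p₂ ⁻¹' (Y₀ : Set Y)) :=
    Dense.preimage (Y₀.2.dense ⟨_, hne.some.2⟩) p₂.isOpenMap
  obtain ⟨x, hxU, hxY⟩ := hd.inter_open_nonempty _ U.2 hU
  obtain ⟨y, hy⟩ : p₂ x ∈ Set.range hY₀.fromSpec := by
    rw [hY₀.range_fromSpec]; exact hxY
  obtain ⟨z, hz, -⟩ := Scheme.exists_preimage_of_isPullback hP' x y hy.symm
  obtain ⟨σ, hσ, hσU⟩ := exists_section_aux m Γ(Y, Y₀) (J ⁻¹ᵁ U) ⟨z, by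
    change J z ∈ U; rw [hz]; exact hxU⟩
  refine ⟨_, hY₀.fromSpec, inferInstance, σ ≫ J, ?_, hσU⟩
  rw [Category.assoc, hJ2, reassoc_of% hσ]

/-! ### The formal part -/

lemma prodK_isPullback {X Y : Scheme.{u}} (sX : X ⟶ Sk k) (sY : Y ⟶ Sk k) :
    ∃ (p₁ : prodK k sX sY ⟶ X) (p₂ : prodK k sX sY ⟶ Y), IsPullback p₁ p₂ sX sY ∧
      prodKStr k sX sY = p₂ ≫ sY :=
  ⟨pullback.fst sX sY, pullback.snd sX sY, IsPullback.of_hasPullback _ _, pullback.condition⟩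

/-- The retraction diagram, built from open immersions instead of opens. -/
lemma mkRetract {Y : Scheme.{u}} [IrreducibleSpace Y] (sY : Y ⟶ Sk k) (n i N : ℕ) (hN : n ≤ N)
    {Z : Scheme.{u}} (sZ : Z ⟶ Sk k) (hZ : IsSmoothVarietyDim k sZ i) {U V : Scheme.{u}}
    [Nonempty U] (u : U ⟶ Y) [IsOpenImmersion u] (v : V ⟶ prodK k (AffSpStr k (N - i)) sZ)
    [IsOpenImmersion v] (f : U ⟶ V) (g : V ⟶ Y)
    (hg : g ≫ sY = v ≫ prodKStr k (AffSpStr k (N - i)) sZ) (hfg : f ≫ g = u) :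
    RetractMinusRational k sY n i := by
  have hI := hZ.1.1
  have : IrreducibleSpace Z := inferInstance
  have : Nonempty V := ⟨f (Classical.arbitrary U)⟩
  have e1 : v.isoOpensRange.hom ≫ v.opensRange.ι = v := by simp
  refine ⟨N, hN, Z, sZ, hZ, u.opensRange, ⊤, v.opensRange, le_top, ?_, ?_, ?_,
    u.isoOpensRange.inv ≫ f ≫ v.isoOpensRange.hom,
    v.isoOpensRange.inv ≫ g ≫ Y.topIso.inv, ?_, ?_, ?_⟩
  · exact u.opensRange.2.dense ⟨_, Classical.arbitrary U, rfl⟩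
  · exact dense_univ
  · exact v.opensRange.2.dense ⟨_, Classical.arbitrary V, rfl⟩
  · simp only [Category.assoc]
    rw [reassoc_of% e1, ← hg, reassoc_of% hfg]
    simp
  · rw [← cancel_epi v.isoOpensRange.hom, reassoc_of% e1, ← hg]
    simp
  · simp [hfg]

lemma core {m r M : ℕ} (hM : m + r ≤ M) {X Y Z : Scheme.{u}} (sX : X ⟶ Sk k) (sY : Y ⟶ Sk k)
    (sZ : Z ⟶ Sk k) {P Q R S : Scheme.{u}} {p₁ : P ⟶ AffSp k m} {p₂ : P ⟶ Z}
    (hP : IsPullback p₁ p₂ (AffSpStr k m) sZ) {q₁ : Q ⟶ AffSp k M} {q₂ : Q ⟶ Z}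
    (hQ : IsPullback q₁ q₂ (AffSpStr k M) sZ) {r₁ : R ⟶ AffSp k r} {r₂ : R ⟶ X}
    (hR : IsPullback r₁ r₂ (AffSpStr k r) sX) {s₂ : S ⟶ Y}
    {W : Scheme.{u}} (w : W ⟶ R) [IsOpenImmersion w] (w' : W ⟶ S)
    (hw : w' ≫ s₂ ≫ sY = w ≫ r₂ ≫ sX)
    {U V : Scheme.{u}} (u : U ⟶ X) (v : V ⟶ P) [IsOpenImmersion v]
    (f : U ⟶ V) (g : V ⟶ X) (hg : g ≫ sX = v ≫ p₂ ≫ sZ) (hfg : f ≫ g = u) :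
    ∃ (Q' : Scheme.{u}) (ι : Q' ⟶ Q) (g' : Q' ⟶ Y), IsOpenImmersion ι ∧
      g' ≫ sY = ι ≫ q₂ ≫ sZ ∧
      ∀ (T : Scheme.{u}) (τ : T ⟶ W) (t : T ⟶ U), τ ≫ w ≫ r₂ = t ≫ u →
        ∃ c : T ⟶ Q', c ≫ g' = τ ≫ w' ≫ s₂ := by
  obtain ⟨p, q, hp, hq, hlift⟩ := exists_affLift k hM
  let qP : Q ⟶ P := hP.lift (q₁ ≫ p) q₂ (by rw [Category.assoc, hp, hQ.w])
  have hqP1 : qP ≫ p₁ = q₁ ≫ p := hP.lift_fst _ _ _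
  have hqP2 : qP ≫ p₂ = q₂ := hP.lift_snd _ _ _
  have hcond : (pullback.fst qP v ≫ q₁ ≫ q) ≫ AffSpStr k r = (pullback.snd qP v ≫ g) ≫ sX := by
    simp only [Category.assoc]
    rw [hq, hg, hQ.w, ← reassoc_of% (pullback.condition (f := qP) (g := v)), reassoc_of% hqP2]
  let h : pullback qP v ⟶ R := hR.lift _ _ hcond
  have h1 : h ≫ r₁ = pullback.fst qP v ≫ q₁ ≫ q := hR.lift_fst _ _ _
  have h2 : h ≫ r₂ = pullback.snd qP v ≫ g := hR.lift_snd _ _ _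
  refine ⟨pullback h w, pullback.fst h w ≫ pullback.fst qP v, pullback.snd h w ≫ w' ≫ s₂,
    inferInstance, ?_, ?_⟩
  · simp only [Category.assoc]
    rw [hw, ← reassoc_of% (pullback.condition (f := h) (g := w)), reassoc_of% h2, hg,
      ← reassoc_of% (pullback.condition (f := qP) (g := v)), reassoc_of% hqP2]
  · intro T τ t hτ
    obtain ⟨c, hc1, hc2⟩ := hlift T (t ≫ f ≫ v ≫ p₁) (τ ≫ w ≫ r₁) (by
      simp only [Category.assoc]
      rw [hP.w, hR.w, reassoc_of% hτ, ← hg, reassoc_of% hfg])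
    let c₀ : T ⟶ Q := hQ.lift c (t ≫ f ≫ v ≫ p₂) (by
      rw [← hp, reassoc_of% hc1]
      simp only [Category.assoc]
      rw [hP.w])
    have hc01 : c₀ ≫ q₁ = c := hQ.lift_fst _ _ _
    have hc02 : c₀ ≫ q₂ = t ≫ f ≫ v ≫ p₂ := hQ.lift_snd _ _ _
    let c₁ : T ⟶ pullback qP v := pullback.lift c₀ (t ≫ f) (by
      apply hP.hom_ext
      · simp only [Category.assoc]
        rw [hqP1, reassoc_of% hc01, hc1]
      · simp only [Category.assoc]
        rw [hqP2, hc02])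
    have hc11 : c₁ ≫ pullback.fst qP v = c₀ := pullback.lift_fst _ _ _
    have hc12 : c₁ ≫ pullback.snd qP v = t ≫ f := pullback.lift_snd _ _ _
    suffices hcomm : c₁ ≫ h = τ ≫ w from
      ⟨pullback.lift c₁ τ hcomm, by rw [← Category.assoc, pullback.lift_snd]⟩
    apply hR.hom_ext
    · simp only [Category.assoc]
      rw [h1, reassoc_of% hc11, reassoc_of% hc01, hc2]
    · simp only [Category.assoc]
      rw [h2, reassoc_of% hc12, hfg, hτ]

/-! ### The finite case -/

lemma poly_aux {σ : Type*} {F : MvPolynomial σ k} (hF : F ≠ 0) (x : Localization.Away F) (n : ℕ)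
    (hn : 1 < n) (hx : x ^ n = x) : ∃ c : k, x = algebraMap k _ c := by
  let K := FractionRing (MvPolynomial σ k)
  let φ : Localization.Away F →ₐ[MvPolynomial σ k] K := 
    IsLocalization.liftAlgHom (M := Submonoid.powers F) (f := Algebra.ofId _ _) (by
      rintro ⟨_, j, rfl⟩
      have hF' : algebraMap (MvPolynomial σ k) K F ≠ 0 := by simpa using hF
      have h3 := (Ne.isUnit hF').pow j
      rw [← map_pow] at h3
      exact h3)
  have hφ : Function.Injective φ := by
    have hle : Submonoid.powers F ≤ nonZeroDivisors (MvPolynomial σ k) :=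
      powers_le_nonZeroDivisors_of_noZeroDivisors hF
    change Function.Injective (IsLocalization.lift (M := Submonoid.powers F) _)
    rw [IsLocalization.lift_injective_iff]
    intro a b
    rw [(IsLocalization.injective (Localization.Away F) hle).eq_iff]
    exact (IsFractionRing.injective (MvPolynomial σ k) K).eq_iff.symm
  have hint : IsIntegral (MvPolynomial σ k) (φ x) := by
    refine ⟨Polynomial.X ^ n - Polynomial.X, Polynomial.monic_X_pow_sub (by simpa using hn), ?_⟩
    simp [← map_pow, hx]
  obtain ⟨G, hG⟩ := IsIntegrallyClosed.isIntegral_iff.mp hint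
  have hGx : algebraMap _ _ G = x := by
    apply hφ; rw [← hG]; simp
  have hGn : G ^ n = G := by
    apply IsFractionRing.injective (MvPolynomial σ k) K
    rw [map_pow, hG, ← map_pow, hx]
  have hdeg : G.totalDegree = 0 := by
    by_cases hG0 : G = 0
    · simp [hG0]
    obtain ⟨l, rfl⟩ : ∃ l, n = l + 2 := ⟨n - 2, by omega⟩
    have h1 := congrArg MvPolynomial.totalDegree hGn
    rw [pow_succ, pow_succ, MvPolynomial.totalDegree_mul_of_isDomain
      (mul_ne_zero (pow_ne_zero _ hG0) hG0) hG0, MvPolynomial.totalDegree_mul_of_isDomain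
      (pow_ne_zero _ hG0) hG0] at h1
    omega
  rw [MvPolynomial.totalDegree_eq_zero_iff_eq_C] at hdeg
  exact ⟨_, by rw [← hGx, hdeg]; rfl⟩

lemma finite_spec (M : ℕ) (B : CommRingCat.{u}) [IsDomain B] [Finite B] (φ : CommRingCat.of k ⟶ B)
    {Q : Scheme.{u}} (ι : Q ⟶ Spec (polyR k M)) [IsOpenImmersion ι] [Nonempty Q]
    (g : Q ⟶ Spec B) (hg : g ≫ Spec.map φ = ι ≫ Spec.map (polyC k M)) : IsIso φ := by
  obtain ⟨_, ⟨F, rfl⟩, hxF, hFU⟩ := (PrimeSpectrum.isTopologicalBasis_basic_opens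
    (R := MvPolynomial (Fin M) k)).exists_subset_of_mem_open
    (show ι (Classical.arbitrary Q) ∈ (ι.opensRange : Set _) from ⟨_, rfl⟩) ι.opensRange.2
  have hF : F ≠ 0 := by
    rintro rfl
    simp only [PrimeSpectrum.basicOpen_zero] at hxF
    exact hxF
  let lo : polyR k M ⟶ CommRingCat.of (Localization.Away F) :=
    CommRingCat.ofHom (algebraMap (MvPolynomial (Fin M) k) (Localization.Away F))
  have hlo : IsOpenImmersion (Spec.map lo) := 
    IsOpenImmersion.of_isLocalization F
  let d : Spec (CommRingCat.of (Localization.Away F)) ⟶ Q :=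
    IsOpenImmersion.lift ι (Spec.map lo) (by
      refine subset_trans (le_of_eq ?_) hFU
      exact PrimeSpectrum.localization_away_comap_range (Localization.Away F) F)
  have hd : d ≫ ι = Spec.map lo := IsOpenImmersion.lift_fac _ _ _
  obtain ⟨ψ, hψ⟩ := Spec.map_surjective (d ≫ g)
  have hcomp : φ ≫ ψ = polyC k M ≫ lo := by
    apply Spec.map_injective
    rw [Spec.map_comp, Spec.map_comp, hψ, Category.assoc, hg, ← hd, Category.assoc]
  let : Field B := (Finite.isField_of_domain B).toField
  have : Nontrivial (Localization.Away F) :=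
    (IsLocalization.injective (Localization.Away F)
      (powers_le_nonZeroDivisors_of_noZeroDivisors hF)).nontrivial
  have hψi : Function.Injective ψ.hom := RingHom.injective ψ.hom
  let := Fintype.ofFinite B
  rw [ConcreteCategory.isIso_iff_bijective]
  refine ⟨RingHom.injective φ.hom, fun b => ?_⟩
  obtain ⟨c, hc⟩ := poly_aux k hF (ψ.hom b) (Fintype.card B) Fintype.one_lt_card (by
    rw [← map_pow, FiniteField.pow_card])
  refine ⟨c, hψi ?_⟩
  rw [hc]
  exact congrArg (fun f => f.hom c) hcomp

lemma finite_case {Y : Scheme.{u}} [IsIntegral Y] [IsAffine Y] (sY : Y ⟶ Sk k)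
    (hfin : Finite Γ(Y, ⊤)) (M : ℕ)
    {Q : Scheme.{u}} (ι : Q ⟶ AffSp k M) [IsOpenImmersion ι] [Nonempty Q]
    (g : Q ⟶ Y) (hg : g ≫ sY = ι ≫ AffSpStr k M) : IsIso sY := by
  obtain ⟨φ, hφ⟩ := Spec.map_surjective (Y.isoSpec.inv ≫ sY)
  have hg2 : (g ≫ Y.isoSpec.hom) ≫ Spec.map φ = ι ≫ AffSpStr k M := by
    rw [hφ, ← hg]
    simp
  have := @finite_spec k _ M Γ(Y, ⊤) _ _ φ Q ι ‹_› _ (g ≫ Y.isoSpec.hom) hg2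
  have h2 : sY = Y.isoSpec.hom ≫ Spec.map φ := by rw [hφ]; simp
  rw [h2]
  infer_instance

lemma subsingleton_of_finite {Y : Scheme.{u}} [IsIntegral Y]
    (h : ∀ A : Y.Opens, IsAffineOpen A → Nonempty A → Finite Γ(Y, A)) : Subsingleton Y := by
  suffices hx : ∀ x : Y, x = genericPoint Y from ⟨fun x y => (hx x).trans (hx y).symm⟩
  intro x
  obtain ⟨A, hA, hxA, -⟩ := Y.isBasis_affineOpens.exists_subset_of_mem_open
    (Set.mem_univ x) isOpen_univ
  obtain ⟨A, hA, rfl⟩ := hA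
  have hA : IsAffineOpen A := hA
  have hne : Nonempty A := ⟨⟨x, hxA⟩⟩
  have := h A hA hne
  have hD : IsDomain Γ(Y, A) := inferInstance
  let : Field Γ(Y, A) := (Finite.isField_of_domain Γ(Y, A)).toField
  have hs : Subsingleton (Spec Γ(Y, A)) :=
    inferInstanceAs (Subsingleton (PrimeSpectrum Γ(Y, A)))
  have hη : genericPoint Y ∈ A := 
    ((genericPoint_spec Y).mem_open_set_iff A.2).mpr ⟨x, trivial, hxA⟩
  obtain ⟨a, rfl⟩ : x ∈ Set.range hA.fromSpec := by rw [hA.range_fromSpec]; exact hxA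
  obtain ⟨b, hb⟩ : genericPoint Y ∈ Set.range hA.fromSpec := by rw [hA.range_fromSpec]; exact hη
  rw [← hb, Subsingleton.elim a b]

lemma oneDirection (X Y : Scheme.{u}) (sX : X ⟶ Sk k) (sY : Y ⟶ Sk k) (nX nY i : ℕ)
    (hX : IsVarietyDim k sX nX) (hY : IsVarietyDim k sY nY)
    (hXY : StablyBirEquiv k sX sY) (hiX : i ≤ nX) (hiY : i ≤ nY)
    (h : RetractMinusRational k sX nX i) : RetractMinusRational k sY nY i := by
  have := hX.1
  have := hY.1
  obtain ⟨N, hN, Z, sZ, hZ, U, U', V, -, hU, -, -, f, g, -, hg, hfg⟩ := h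
  have hZi := hZ.1.1
  obtain ⟨r, s, W, W', e, hW, hW', he⟩ := hXY
  obtain ⟨p₁, p₂, hP, hPs⟩ := prodK_isPullback k (AffSpStr k (N - i)) sZ
  obtain ⟨q₁, q₂, hQ, hQs⟩ := prodK_isPullback k (AffSpStr k (N + r + nY - i)) sZ
  obtain ⟨r₁, r₂, hR, hRs⟩ := prodK_isPullback k (AffSpStr k r) sX
  obtain ⟨s₁, s₂, hS, hSs⟩ := prodK_isPullback k (AffSpStr k s) sY
  rw [hPs] at hg
  rw [hRs, hSs] at he
  obtain ⟨Q', ι, g', hι, hg', hlift⟩ := core k (m := N - i) (r := r) (M := N + r + nY - i)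
    (by omega) sX sY sZ hP hQ hR (s₂ := s₂) W.ι (e.hom ≫ W'.ι)
    (by simpa using he) U.ι V.ι f (g ≫ U'.ι) (by simpa using hg) hfg
  have : UniversallyOpen r₂ := MorphismProperty.of_isPullback hR (univOpen_affSp k r)
  have hWne : Nonempty W := by
    obtain ⟨x, -, hx⟩ := hW.inter_open_nonempty _ isOpen_univ
      (Set.univ_nonempty (α := prodK k (AffSpStr k r) sX))
    exact ⟨⟨x, hx⟩⟩
  let W₀ := pullback (W.ι ≫ r₂) U.ι
  let w₀ : W₀ ⟶ W := pullback.fst _ _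
  let t₀ : W₀ ⟶ U := pullback.snd _ _
  have hw₀ : w₀ ≫ W.ι ≫ r₂ = t₀ ≫ U.ι := pullback.condition
  have hW₀ne : Nonempty W₀ := by
    obtain ⟨x, ⟨y, rfl⟩, hx⟩ := hU.inter_open_nonempty (Set.range (W.ι ≫ r₂))
      (W.ι ≫ r₂).isOpenMap.isOpen_range (Set.range_nonempty _)
    obtain ⟨z, -⟩ := Scheme.Pullback.exists_preimage_pullback (f := W.ι ≫ r₂) (g := U.ι) y ⟨_, hx⟩ rfl
    exact ⟨z⟩
  by_cases hinf : ∃ A : Y.Opens, IsAffineOpen A ∧ Nonempty A ∧ Infinite Γ(Y, A)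
  · obtain ⟨A, hA, hAne, hAinf⟩ := hinf
    let w₁ : W₀ ⟶ prodK k (AffSpStr k s) sY := w₀ ≫ e.hom ≫ W'.ι
    have : IsOpenImmersion w₁ := inferInstance
    obtain ⟨S, a, ha, σ, hσ, hσne⟩ := exists_section k sY s A hA hAne hAinf hS w₁.opensRange
      ⟨_, Classical.arbitrary W₀, rfl⟩
    obtain ⟨y, ⟨z, hz⟩⟩ := hσne
    have : Nonempty ↥(pullback σ w₁) := by
      obtain ⟨z, -⟩ := Scheme.Pullback.exists_preimage_pullback (f := σ) (g := w₁) y z hz.symm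
      exact ⟨z⟩
    obtain ⟨c, hc⟩ := hlift (pullback σ w₁) (pullback.snd σ w₁ ≫ w₀) (pullback.snd σ w₁ ≫ t₀)
      (by simp only [Category.assoc, hw₀])
    refine mkRetract k sY nY i (N + r + nY) (by omega) sZ hZ (pullback.fst σ w₁ ≫ a) ι c g' ?_ ?_
    · rw [hg', hQs]
    · rw [hc, ← hσ, Category.assoc, reassoc_of% (pullback.condition (f := σ) (g := w₁))]
      simp [w₁]
  · have hfin : ∀ A : Y.Opens, IsAffineOpen A → Nonempty A → Finite Γ(Y, A) := by
      intro A hA hne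
      by_contra hcon
      exact hinf ⟨A, hA, hne, not_finite_iff_infinite.mp hcon⟩
    have hsub := subsingleton_of_finite hfin
    have hi0 : i = 0 := by
      have h0 := topologicalKrullDim_zero_of_discreteTopology Y
      rw [hY.2.2.2.2] at h0
      have : nY ≤ 0 := by exact_mod_cast h0
      omega
    subst hi0
    have hZiso : IsIso sZ := hZ.2.2 rfl
    have hq₁ : IsIso q₁ := MorphismProperty.of_isPullback (P := .isomorphisms Scheme) hQ.flip hZiso
    have hYaff : IsAffine Y := inferInstance
    have htop : Nonempty (⊤ : Y.Opens) := ⟨⟨genericPoint Y, trivial⟩⟩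
    obtain ⟨c, -⟩ := hlift W₀ w₀ t₀ hw₀
    have : Nonempty Q' := ⟨c (Classical.arbitrary W₀)⟩
    have hiso : IsIso sY := finite_case k sY (hfin ⊤ (isAffineOpen_top Y) htop) _
      (ι ≫ q₁) g' (by rw [hg', Category.assoc, hQ.w])
    obtain ⟨l₁, l₂, hL, hLs⟩ := prodK_isPullback k (AffSpStr k (nY - 0)) sZ
    obtain ⟨o, ho⟩ : ∃ o : Sk k ⟶ AffSp k (nY - 0), o ≫ AffSpStr k (nY - 0) = 𝟙 _ := by
      refine ⟨Spec.map (CommRingCat.ofHom (MvPolynomial.eval 0)), ?_⟩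
      refine (Spec.map_comp _ _).symm.trans ?_
      rw [← Spec.map_id]
      congr 1
      ext x
      simp
    refine mkRetract k sY nY 0 nY le_rfl sZ hZ (𝟙 Y) (𝟙 _)
      (hL.lift (sY ≫ o) (sY ≫ inv sZ) (by
        rw [Category.assoc, ho]; simp)) (l₂ ≫ sZ ≫ inv sY) ?_ ?_
    · rw [hLs]; simp
    · rw [← Category.assoc, hL.lift_snd]; simp

lemma stablyBirEquiv_symm {X Y : Scheme.{u}} {sX : X ⟶ Sk k} {sY : Y ⟶ Sk k}
    (h : StablyBirEquiv k sX sY) : StablyBirEquiv k sY sX := by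
  obtain ⟨r, s, U, V, e, hU, hV, he⟩ := h
  exact ⟨s, r, V, U, e.symm, hV, hU, by rw [← he]; simp⟩

/-- Retract `(-i)`-rationality is a stably birational invariant: if `X`, `Y`
are stably birationally equivalent varieties over a perfect field `k` and `0 ≤ i ≤ dim X`,
`0 ≤ i ≤ dim Y`, then `X` is retract `(-i)`-rational iff `Y` is. -/
theorem retractMinusRational_stablyBirEquiv_invariant (k : Type u) [Field k] [PerfectField k]
    (X Y : Scheme.{u}) (sX : X ⟶ Sk k) (sY : Y ⟶ Sk k) (nX nY i : ℕ)
    (hX : IsVarietyDim k sX nX) (hY : IsVarietyDim k sY nY)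
    (hXY : StablyBirEquiv k sX sY) (hiX : i ≤ nX) (hiY : i ≤ nY) :
    RetractMinusRational k sX nX i ↔ RetractMinusRational k sY nY i := by
  exact ⟨oneDirection k X Y sX sY nX nY i hX hY hXY hiX hiY,
    oneDirection k Y X sY sX nY nX i hY hX (stablyBirEquiv_symm k hXY) hiY hiX⟩
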